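/- Let X ⊆ ℝⁿ be compact, T ∈ ℕ, E : X → ℝᵐ continuous with injective sum map Ê on multisets of size ≤ T, and let π* : S × M_{≤T}(X) → ℝᵏ be continuous, where S ⊆ ℝᵖ. Then there exists a continuous function π : S × ℝᵐ → ℝᵏ such that for every s ∈ S, t ≤ T, and x_1, …, x_t ∈ X: π(s, Σ_{i=1}^t E(x_i)) = π*(s, {{x_1, …, x_t}}). -/

import Mathlib

/-- The setoid on `Fin t → X` identifying tuples up to a permutation of coordinates.
Its quotient is the space of multisets of size `t` with elements in `X`. -/
def permSetoid (X : Type*) (t : ℕ) : Setoid (Fin t → X) where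
  r a b := ∃ ρ : Equiv.Perm (Fin t), a ∘ ρ = b
  iseqv := by
    constructor
    · intro a; exact ⟨Equiv.refl _, rfl⟩
    · rintro a b ⟨ρ, rfl⟩
      exact ⟨ρ.symm, by funext i; simp⟩
    · rintro a b c ⟨ρ, rfl⟩ ⟨τ, rfl⟩
      exact ⟨τ.trans ρ, rfl⟩


/-- (Existence of the policy network, Proposition 3.1 abstraction.)
For compact `X ⊆ ℝⁿ`, continuous `E : X → ℝᵐ` whose sum map is injective on multisets of
size at most `T`, and a continuous map `π* : S × M_{≤T}(X) → ℝᵏ` with `S ⊆ ℝᵖ`, there is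
a continuous `π : S × ℝᵐ → ℝᵏ` with `π(s, Σᵢ E(xᵢ)) = π*(s, {{x_1, …, x_t}})` for all
`s ∈ S`, `t ≤ T`, and `x_1, …, x_t ∈ X`. -/
theorem exists_continuous_policy
    (n m p k T : ℕ) (s : Set (EuclideanSpace ℝ (Fin n))) (hs : IsCompact s)
    (S : Set (EuclideanSpace ℝ (Fin p)))
    (E : {x // x ∈ s} → EuclideanSpace ℝ (Fin m)) (hE : Continuous E)
    (hinj : ∀ (t₁ t₂ : Fin (T + 1)) (v : Fin (t₁ : ℕ) → {x // x ∈ s})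
      (w : Fin (t₂ : ℕ) → {x // x ∈ s}),
      ∑ i, E (v i) = ∑ i, E (w i) →
        (⟨t₁, Quotient.mk (permSetoid {x // x ∈ s} t₁) v⟩ :
          Σ t : Fin (T + 1), Quotient (permSetoid {x // x ∈ s} t))
          = ⟨t₂, Quotient.mk (permSetoid {x // x ∈ s} t₂) w⟩)
    (πstar : {y // y ∈ S} × (Σ t : Fin (T + 1), Quotient (permSetoid {x // x ∈ s} t)) →
      (Fin k → ℝ))
    (hπ : Continuous πstar) :
    ∃ π : {y // y ∈ S} × EuclideanSpace ℝ (Fin m) → (Fin k → ℝ),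
      Continuous π ∧
        ∀ (y : {y // y ∈ S}) (t : Fin (T + 1)) (v : Fin (t : ℕ) → {x // x ∈ s}),
          π (y, ∑ i, E (v i))
            = πstar (y, ⟨t, Quotient.mk (permSetoid {x // x ∈ s} t) v⟩) := by
  have : CompactSpace {x // x ∈ s} := isCompact_iff_compactSpace.mp hs
  let F : (Σ t : Fin (T + 1), Quotient (permSetoid {x // x ∈ s} t)) →
      EuclideanSpace ℝ (Fin m) := fun q =>
    Quotient.lift (fun v : Fin (q.1 : ℕ) → {x // x ∈ s} => ∑ i, E (v i))
      (by
        rintro a b ⟨ρ, rfl⟩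
        exact (Equiv.sum_comp ρ (fun i => E (a i))).symm) q.2
  have hFc : Continuous F := by
    refine continuous_sigma fun t => ?_
    have hc : Continuous (fun v : Fin (t : ℕ) → {x // x ∈ s} => ∑ i, E (v i)) := by
      fun_prop
    have hr : ∀ a b : Fin (t : ℕ) → {x // x ∈ s},
        (permSetoid {x // x ∈ s} t) a b → ∑ i, E (a i) = ∑ i, E (b i) := by
      rintro a b ⟨ρ, rfl⟩
      exact (Equiv.sum_comp ρ (fun i => E (a i))).symm
    exact hc.quotient_lift hr
  have hFi : Function.Injective F := by
    rintro ⟨t₁, q₁⟩ ⟨t₂, q₂⟩ h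
    induction q₁ using Quotient.inductionOn with
    | _ v =>
      induction q₂ using Quotient.inductionOn with
      | _ w => exact hinj t₁ t₂ v w h
  have hF : Topology.IsClosedEmbedding F := hFc.isClosedEmbedding hFi
  have hG : Topology.IsClosedEmbedding
      (Prod.map (id : {y // y ∈ S} → {y // y ∈ S}) F) :=
    Topology.IsClosedEmbedding.id.prodMap hF
  obtain ⟨g, hg⟩ := ContinuousMap.exists_extension hG ⟨πstar, hπ⟩
  refine ⟨g, g.continuous, fun y t v => ?_⟩
  exact DFunLike.congr_fun hg (y, ⟨t, Quotient.mk (permSetoid {x // x ∈ s} t) v⟩)
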